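/- Let ψ : ℝ → ℝ → ℝ be twice differentiable in each variable with ∂²_xψ + ∂²_yψ = 0 at every point (harmonic). Fix a constant h₀ > 0 and v₀ ∈ ℝ. Let f : (ℝ × ℝ) → ℝ → ℝ, written f(x,v) with x ∈ ℝ × ℝ, be such that all partial derivatives appearing below exist and are continuous in v, with ∂_vf(x,v) > 0 everywhere, and let f₀ : ℝ × ℝ → ℝ satisfy f(x,v) > f₀(x) for all (x,v). Define h₄(x,v) = h₀·(∂_vf(x,v))², h₅(x,v) = (f(x,v) − f₀(x))², let w : (ℝ × ℝ) × ℝ → ℝ be an arbitrary function, let c₁, c₂ : ℝ × ℝ → ℝ be arbitrary, and define n(x,v) = c₁(x) + c₂(x)·∫_{v₀}^{v} h₄(x,t)/(h₅(x,t))^{3/2} dt. Then at every point (x,v), with φ = log(∂_vh₅/√(h₄h₅)) and with ∂_k (k = 1,2) the partial derivatives in the two components of x: (i) for g₂ = g₃ = e^{ψ}: (1/(2g₂g₃))·[ ∂₁g₂·∂₁g₃/(2g₂) + (∂₁g₃)²/(2g₃) − ∂₁²g₃ + ∂₂g₂·∂₂g₃/(2g₃) + (∂₂g₂)²/(2g₂)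 − ∂₂²g₂ ] = 0; (ii) ∂_vφ·∂_vh₅ = 0; (iii) for k = 1,2: w·[ ∂²_vh₅ − (∂_vh₅)²/(2h₅) − ∂_vh₄·∂_vh₅/(2h₄) ] + (∂_vh₅/2)·( ∂_kh₄/h₄ + ∂_kh₅/h₅ ) − ∂_k(∂_vh₅) = 0; (iv) ∂²_vn + ( (3/2)·∂_vh₅/h₅ − ∂_vh₄/h₄ )·∂_vn = 0. -/

import Mathlib

/-- Partial derivative in the first variable of a two-variable real function. -/
noncomputable def pdx (f : ℝ → ℝ → ℝ) (x y : ℝ) : ℝ := deriv (fun t => f t y) x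

/-- Partial derivative in the second variable of a two-variable real function. -/
noncomputable def pdy (f : ℝ → ℝ → ℝ) (x y : ℝ) : ℝ := deriv (fun t => f x t) y

/-- Second partial derivative in the first variable. -/
noncomputable def pdxx (f : ℝ → ℝ → ℝ) (x y : ℝ) : ℝ := deriv (fun t => pdx f t y) x

/-- Second partial derivative in the second variable. -/
noncomputable def pdyy (f : ℝ → ℝ → ℝ) (x y : ℝ) : ℝ := deriv (fun t => pdy f x t) y

/-- Partial derivative in the anisotropic coordinate v. -/
noncomputable def pV (F : (ℝ × ℝ) → ℝ → ℝ) (x : ℝ × ℝ) (v : ℝ) : ℝ :=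
  deriv (fun t => F x t) v

/-- Second partial derivative in the anisotropic coordinate v. -/
noncomputable def pVV (F : (ℝ × ℝ) → ℝ → ℝ) (x : ℝ × ℝ) (v : ℝ) : ℝ :=
  deriv (fun t => pV F x t) v

/-- Partial derivative in the first horizontal coordinate. -/
noncomputable def p1 (F : (ℝ × ℝ) → ℝ → ℝ) (x : ℝ × ℝ) (v : ℝ) : ℝ :=
  deriv (fun t => F (t, x.2) v) x.1

/-- Partial derivative in the second horizontal coordinate. -/
noncomputable def p2 (F : (ℝ × ℝ) → ℝ → ℝ) (x : ℝ × ℝ) (v : ℝ) : ℝ :=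
  deriv (fun t => F (x.1, t) v) x.2

/-- The horizontal Ricci expression of equation (4ep1a) for a diagonal block g₂, g₃. -/
noncomputable def Eexpr (g₂ g₃ : ℝ → ℝ → ℝ) (x y : ℝ) : ℝ :=
  (1 / (2 * g₂ x y * g₃ x y)) *
    (pdx g₂ x y * pdx g₃ x y / (2 * g₂ x y) + (pdx g₃ x y) ^ 2 / (2 * g₃ x y)
      - pdxx g₃ x y
      + pdy g₂ x y * pdy g₃ x y / (2 * g₃ x y) + (pdy g₂ x y) ^ 2 / (2 * g₂ x y)
      - pdyy g₂ x y)

theorem rpow_sq_three_halves {a : ℝ} (ha : 0 ≤ a) : (a ^ 2) ^ ((3 : ℝ) / 2) = a ^ 3 := by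
  rw [← Real.rpow_natCast a 2, ← Real.rpow_mul ha, ← Real.rpow_natCast a 3]
  norm_num

theorem sqrt_const_mul_sq_mul_sq {c a b : ℝ} (hc : 0 ≤ c) (ha : 0 ≤ a) (hb : 0 ≤ b) :
    Real.sqrt (c * a ^ 2 * b ^ 2) = Real.sqrt c * (a * b) := by
  rw [mul_assoc, ← mul_pow, Real.sqrt_mul hc, Real.sqrt_sq (mul_nonneg ha hb)]

/-- Differentiating `exp ∘ u` twice along a line. -/
theorem deriv_deriv_exp_comp {u : ℝ → ℝ} (hu : Differentiable ℝ u)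
    (hu' : Differentiable ℝ (deriv u)) (x : ℝ) :
    deriv (fun t => deriv (fun s => Real.exp (u s)) t) x
      = Real.exp (u x) * (deriv u x ^ 2 + deriv (deriv u) x) := by
  have h : (fun t => deriv (fun s => Real.exp (u s)) t)
      = fun t => Real.exp (u t) * deriv u t :=
    funext fun t => (hu t).hasDerivAt.exp.deriv
  rw [h, ((hu x).hasDerivAt.exp.fun_mul (hu' x).hasDerivAt).deriv]
  ring

/-- The conformally flat block `exp ψ` has Ricci expression proportional to the Laplacian of `ψ`,
so it vanishes for harmonic `ψ`. -/
theorem Eexpr_exp_eq_zero {ψ : ℝ → ℝ → ℝ}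
    (hψx : ∀ x y, DifferentiableAt ℝ (fun t => ψ t y) x)
    (hψxx : ∀ x y, DifferentiableAt ℝ (fun t => pdx ψ t y) x)
    (hψy : ∀ x y, DifferentiableAt ℝ (fun t => ψ x t) y)
    (hψyy : ∀ x y, DifferentiableAt ℝ (fun t => pdy ψ x t) y)
    (hharm : ∀ x y, pdxx ψ x y + pdyy ψ x y = 0) (x y : ℝ) :
    Eexpr (fun a b => Real.exp (ψ a b)) (fun a b => Real.exp (ψ a b)) x y = 0 := by
  have hx : pdx (fun a b => Real.exp (ψ a b)) x y = Real.exp (ψ x y) * pdx ψ x y :=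
    (hψx x y).hasDerivAt.exp.deriv
  have hy : pdy (fun a b => Real.exp (ψ a b)) x y = Real.exp (ψ x y) * pdy ψ x y :=
    (hψy x y).hasDerivAt.exp.deriv
  have hxx : pdxx (fun a b => Real.exp (ψ a b)) x y
      = Real.exp (ψ x y) * (pdx ψ x y ^ 2 + pdxx ψ x y) :=
    deriv_deriv_exp_comp (u := fun t => ψ t y) (fun t => hψx t y) (fun t => hψxx t y) x
  have hyy : pdyy (fun a b => Real.exp (ψ a b)) x y
      = Real.exp (ψ x y) * (pdy ψ x y ^ 2 + pdyy ψ x y) :=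
    deriv_deriv_exp_comp (u := fun t => ψ x t) (fun t => hψy x t) (fun t => hψyy x t) y
  have hlap : pdxx ψ x y = -pdyy ψ x y := eq_neg_of_add_eq_zero_left (hharm x y)
  have hne := (Real.exp_pos (ψ x y)).ne'
  simp only [Eexpr, hx, hy, hxx, hyy, hlap]
  field_simp
  ring

/-- The horizontal equation for `h₄ = c * b ^ 2`, `h₅ = a ^ 2` with `b = ∂ᵥa`: the coefficient of
`w` vanishes, and so does the remainder (`b'` is `∂ᵥb`, `da`, `db` are horizontal derivatives). -/
theorem horizontal_identity {a b c : ℝ} (ha : a ≠ 0) (hb : b ≠ 0) (hc : c ≠ 0)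
    (b' da db w : ℝ) :
    w * (2 * (b * b + a * b') - (2 * (a * b)) ^ 2 / (2 * a ^ 2)
        - c * (2 * b * b') * (2 * (a * b)) / (2 * (c * b ^ 2)))
      + (2 * (a * b) / 2) * (c * (2 * b * db) / (c * b ^ 2) + 2 * a * da / a ^ 2)
      - 2 * (da * b + a * db) = 0 := by
  field_simp
  ring

/-- Vacuum, first-shell (k = 0) instance of the Main Theorem: a harmonic ψ,
a generating function f with ∂_v f > 0, integration data h₀ > 0, f₀(x), c₁(x), c₂(x)
and arbitrary coefficients w produce an exact solution of the whole PDE system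
(4ep1a)–(4ep4a) with vanishing sources Υ₂ = Υ₄ = 0. -/
theorem stmt_17 (ψ : ℝ → ℝ → ℝ)
    (hψx : ∀ x y, DifferentiableAt ℝ (fun t => ψ t y) x)
    (hψxx : ∀ x y, DifferentiableAt ℝ (fun t => pdx ψ t y) x)
    (hψy : ∀ x y, DifferentiableAt ℝ (fun t => ψ x t) y)
    (hψyy : ∀ x y, DifferentiableAt ℝ (fun t => pdy ψ x t) y)
    (hharm : ∀ x y, pdxx ψ x y + pdyy ψ x y = 0)
    (h₀ : ℝ) (hh₀ : 0 < h₀) (v₀ : ℝ)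
    (f : (ℝ × ℝ) → ℝ → ℝ)
    (hfv : ∀ (x : ℝ × ℝ) (v : ℝ), DifferentiableAt ℝ (fun t => f x t) v)
    (hfvv : ∀ (x : ℝ × ℝ) (v : ℝ), DifferentiableAt ℝ (fun t => pV f x t) v)
    (hfvpos : ∀ (x : ℝ × ℝ) (v : ℝ), 0 < pV f x v)
    (hfcont : ∀ x : ℝ × ℝ, Continuous (fun v => f x v))
    (hfvcont : ∀ x : ℝ × ℝ, Continuous (fun v => pV f x v))
    (hfvvcont : ∀ x : ℝ × ℝ, Continuous (fun v => pVV f x v))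
    (hf1 : ∀ (x : ℝ × ℝ) (v : ℝ), DifferentiableAt ℝ (fun t => f (t, x.2) v) x.1)
    (hf2 : ∀ (x : ℝ × ℝ) (v : ℝ), DifferentiableAt ℝ (fun t => f (x.1, t) v) x.2)
    (hfv1 : ∀ (x : ℝ × ℝ) (v : ℝ), DifferentiableAt ℝ (fun t => pV f (t, x.2) v) x.1)
    (hfv2 : ∀ (x : ℝ × ℝ) (v : ℝ), DifferentiableAt ℝ (fun t => pV f (x.1, t) v) x.2)
    (f₀ : ℝ × ℝ → ℝ)
    (hf₀1 : ∀ x : ℝ × ℝ, DifferentiableAt ℝ (fun t => f₀ (t, x.2)) x.1)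
    (hf₀2 : ∀ x : ℝ × ℝ, DifferentiableAt ℝ (fun t => f₀ (x.1, t)) x.2)
    (hff₀ : ∀ (x : ℝ × ℝ) (v : ℝ), f₀ x < f x v)
    (h₄ h₅ : (ℝ × ℝ) → ℝ → ℝ)
    (h4def : ∀ x v, h₄ x v = h₀ * (pV f x v) ^ 2)
    (h5def : ∀ x v, h₅ x v = (f x v - f₀ x) ^ 2)
    (w : (ℝ × ℝ) × ℝ → ℝ)
    (c₁ c₂ : ℝ × ℝ → ℝ)
    (n : (ℝ × ℝ) → ℝ → ℝ)
    (hndef : ∀ x v, n x v = c₁ x + c₂ x * ∫ t in v₀..v, h₄ x t / (h₅ x t) ^ ((3:ℝ)/2)) :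
    -- (i) equation (4ep1a) with Υ₄ = 0 for g₂ = g₃ = e^ψ
    (∀ x y, Eexpr (fun a b => Real.exp (ψ a b)) (fun a b => Real.exp (ψ a b)) x y = 0) ∧
    -- (ii) equation (4ep2a) with Υ₂ = 0, in the form ∂_vφ·∂_vh₅ = 0
    (∀ x v,
      pV (fun x' v' => Real.log (pV h₅ x' v' / Real.sqrt (h₄ x' v' * h₅ x' v'))) x v
        * pV h₅ x v = 0) ∧
    -- (iii) equation (4ep3a), the expression 2h₅·R̂_{4k} = 0, for k = 1
    (∀ x v,
      w (x, v) * (pVV h₅ x v - (pV h₅ x v) ^ 2 / (2 * h₅ x v)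
          - pV h₄ x v * pV h₅ x v / (2 * h₄ x v))
        + (pV h₅ x v / 2) * (p1 h₄ x v / h₄ x v + p1 h₅ x v / h₅ x v)
        - p1 (fun a b => pV h₅ a b) x v = 0) ∧
    -- (iii) equation (4ep3a) for k = 2
    (∀ x v,
      w (x, v) * (pVV h₅ x v - (pV h₅ x v) ^ 2 / (2 * h₅ x v)
          - pV h₄ x v * pV h₅ x v / (2 * h₄ x v))
        + (pV h₅ x v / 2) * (p2 h₄ x v / h₄ x v + p2 h₅ x v / h₅ x v)
        - p2 (fun a b => pV h₅ a b) x v = 0) ∧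
    -- (iv) equation (4ep4a)
    (∀ x v,
      pVV n x v + ((3/2) * pV h₅ x v / h₅ x v - pV h₄ x v / h₄ x v) * pV n x v = 0) := by
  have hb (x : ℝ × ℝ) (v : ℝ) : pV f x v ≠ 0 := (hfvpos x v).ne'
  have hapos (x : ℝ × ℝ) (v : ℝ) : 0 < f x v - f₀ x := sub_pos.2 (hff₀ x v)
  have ha (x : ℝ × ℝ) (v : ℝ) : f x v - f₀ x ≠ 0 := (hapos x v).ne'
  have hc : h₀ ≠ 0 := hh₀.ne'
  obtain rfl : h₄ = fun x v => h₀ * (pV f x v) ^ 2 := funext₂ h4def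
  obtain rfl : h₅ = fun x v => (f x v - f₀ x) ^ 2 := funext₂ h5def
  have hda (x : ℝ × ℝ) (v : ℝ) : HasDerivAt (fun t => f x t - f₀ x) (pV f x v) v :=
    (hfv x v).hasDerivAt.sub_const _
  have hdb (x : ℝ × ℝ) (v : ℝ) : HasDerivAt (fun t => pV f x t) (pVV f x v) v :=
    (hfvv x v).hasDerivAt
  have hV5 : pV (fun x v => (f x v - f₀ x) ^ 2)
      = fun x v => 2 * ((f x v - f₀ x) * pV f x v) := by
    funext x v
    refine ((hda x v).fun_pow 2).deriv.trans ?_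
    push_cast
    ring
  have hV4 (x : ℝ × ℝ) (v : ℝ) : pV (fun x v => h₀ * (pV f x v) ^ 2) x v
      = h₀ * (2 * pV f x v * pVV f x v) := by
    refine (((hdb x v).fun_pow 2).const_mul h₀).deriv.trans ?_
    push_cast
    ring
  have hVV5 (x : ℝ × ℝ) (v : ℝ) : pVV (fun x v => (f x v - f₀ x) ^ 2) x v
      = 2 * (pV f x v * pV f x v + (f x v - f₀ x) * pVV f x v) := by
    rw [pVV, hV5]
    exact (((hda x v).fun_mul (hdb x v)).const_mul 2).deriv
  refine ⟨Eexpr_exp_eq_zero hψx hψxx hψy hψyy hharm, fun x v => ?_, fun x v => ?_, fun x v => ?_,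
    fun x v => ?_⟩
  · have hφ (x : ℝ × ℝ) (v : ℝ) : 2 * ((f x v - f₀ x) * pV f x v) /
        Real.sqrt (h₀ * (pV f x v) ^ 2 * (f x v - f₀ x) ^ 2) = 2 / Real.sqrt h₀ := by
      rw [sqrt_const_mul_sq_mul_sq hh₀.le (hfvpos x v).le (hapos x v).le,
        mul_comm (pV f x v)]
      exact mul_div_mul_right _ _ (mul_ne_zero (ha x v) (hb x v))
    simp only [hV5, hφ]
    simp [pV]
  · have hDa : HasDerivAt (fun t => f (t, x.2) v - f₀ (t, x.2))
        (deriv (fun t => f (t, x.2) v - f₀ (t, x.2)) x.1) x.1 :=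
      ((hf1 x v).sub (hf₀1 x)).hasDerivAt
    have hDb := (hfv1 x v).hasDerivAt
    have h4 := ((hDb.fun_pow 2).const_mul h₀).deriv
    have h5 := (hDa.fun_pow 2).deriv
    have h5' := ((hDa.fun_mul hDb).const_mul 2).deriv
    rw [hVV5, hV4]
    simp only [hV5, p1]
    refine Eq.trans ?_ (horizontal_identity (ha x v) (hb x v) hc (pVV f x v)
      (deriv (fun t => f (t, x.2) v - f₀ (t, x.2)) x.1)
      (deriv (fun t => pV f (t, x.2) v) x.1) (w (x, v)))
    rw [h4, h5, h5']
    norm_num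
  · have hDa : HasDerivAt (fun t => f (x.1, t) v - f₀ (x.1, t))
        (deriv (fun t => f (x.1, t) v - f₀ (x.1, t)) x.2) x.2 :=
      ((hf2 x v).sub (hf₀2 x)).hasDerivAt
    have hDb := (hfv2 x v).hasDerivAt
    have h4 := ((hDb.fun_pow 2).const_mul h₀).deriv
    have h5 := (hDa.fun_pow 2).deriv
    have h5' := ((hDa.fun_mul hDb).const_mul 2).deriv
    rw [hVV5, hV4]
    simp only [hV5, p2]
    refine Eq.trans ?_ (horizontal_identity (ha x v) (hb x v) hc (pVV f x v)
      (deriv (fun t => f (x.1, t) v - f₀ (x.1, t)) x.2)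
      (deriv (fun t => pV f (x.1, t) v) x.2) (w (x, v)))
    rw [h4, h5, h5']
    norm_num
  · have hn (x : ℝ × ℝ) (v : ℝ) :
        pV n x v = c₂ x * (h₀ * (pV f x v) ^ 2 / (f x v - f₀ x) ^ 3) := by
      have hcont : Continuous fun t => h₀ * (pV f x t) ^ 2 / (f x t - f₀ x) ^ 3 :=
        (((hfvcont x).pow 2).const_mul h₀).div (((hfcont x).sub continuous_const).pow 3)
          fun t => pow_ne_zero 3 (ha x t)
      have hnx : (fun t => n x t) = fun t =>
          c₁ x + c₂ x * ∫ s in v₀..t, h₀ * (pV f x s) ^ 2 / (f x s - f₀ x) ^ 3 := by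
        funext t
        simp only [hndef, rpow_sq_three_halves (hapos x _).le]
      rw [pV, hnx]
      exact (((hcont.integral_hasStrictDerivAt v₀ v).hasDerivAt.const_mul _).const_add _).deriv
    have hnn : pVV n x v = _ :=
      (congrArg (fun u => deriv u v) (funext (hn x))).trans
        (((((hdb x v).fun_pow 2).const_mul h₀).fun_div ((hda x v).fun_pow 3)
          (pow_ne_zero 3 (ha x v))).const_mul (c₂ x)).deriv
    have hax := ha x v
    have hbx := hb x v
    rw [hnn, hn, hV4]
    simp only [hV5]
    push_cast
    field_simp
    ring
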